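/- Let q ≥ 2 be an integer and let θ₃(q) := Σ_{n=0}^∞ q^{-n³}. Then θ₃(q) is not a root of any nonzero polynomial with integer coefficients of degree at most 3; equivalently, the numbers 1, θ₃(q), θ₃(q)², θ₃(q)³ are linearly independent over ℚ. -/

import Mathlib

/-- The cubic theta value `θ₃(q) = ∑_{n=0}^∞ q^{-n³}`. -/
noncomputable def theta3 (q : ℕ) : ℝ := ∑' n : ℕ, (1 : ℝ) / (q : ℝ) ^ (n ^ 3)

section theta

open Finset

/-- The number of representations of `h` as a sum of four cubes in `ZMod p`. -/
noncomputable def fourCubeCount (p : ℕ) [NeZero p] (h : ZMod p) : ℝ :=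
  ∑ x : ZMod p, ∑ y : ZMod p, ∑ z : ZMod p, ∑ w : ZMod p,
    if x ^ 3 + y ^ 3 + z ^ 3 + w ^ 3 = h then 1 else 0

/-- The cubic exponential sum modulo `p`. -/
noncomputable def cubicExpSum (p : ℕ) [NeZero p] (t : ZMod p) : ℂ :=
  ∑ x : ZMod p, ZMod.stdAddChar (t * x ^ 3)

section prime
variable {p : ℕ} [hp : Fact p.Prime]

lemma sum_stdAddChar_mul (b : ZMod p) :
    ∑ t : ZMod p, ZMod.stdAddChar (t * b) = if b = 0 then (p : ℂ) else 0 := by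
  rw [AddChar.sum_mulShift b (ZMod.isPrimitive_stdAddChar p), ZMod.card]
  split_ifs <;> simp

lemma card_cube_eq_le (a : ZMod p) : #{x : ZMod p | x ^ 3 = a} ≤ 3 := by
  have h := Polynomial.card_nthRoots 3 a
  refine le_trans (le_trans (card_le_card (t := (Polynomial.nthRoots 3 a).toFinset) ?_)
    (Multiset.toFinset_card_le _)) h
  intro x hx
  simpa [Polynomial.mem_nthRoots] using hx

lemma sum_normSq_cubicExpSum_le :
    ∑ t : ZMod p, Complex.normSq (cubicExpSum p t) ≤ 3 * (p : ℝ) ^ 2 := by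
  have key : ((∑ t : ZMod p, Complex.normSq (cubicExpSum p t) : ℝ) : ℂ)
      = ((p * ∑ y : ZMod p, (#{x : ZMod p | x ^ 3 = y ^ 3} : ℝ) : ℝ) : ℂ) := by
    push_cast
    simp_rw [Complex.normSq_eq_conj_mul_self, cubicExpSum, map_sum, sum_mul_sum,
      ← AddChar.map_neg_eq_conj, ← AddChar.map_add_eq_mul]
    rw [sum_comm, mul_sum]
    refine sum_congr rfl fun y _ => ?_
    rw [sum_comm]
    have : ∀ x : ZMod p, ∑ t : ZMod p, (ZMod.stdAddChar (-(t * y ^ 3) + t * x ^ 3) : ℂ)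
        = if x ^ 3 = y ^ 3 then (p : ℂ) else 0 := by
      intro x
      simp_rw [← sub_eq_zero (a := x ^ 3), ← sum_stdAddChar_mul]
      refine sum_congr rfl fun t _ => ?_
      congr 1; ring
    simp_rw [this, ← sum_filter, sum_const, nsmul_eq_mul, mul_comm]
  rw [Complex.ofReal_inj] at key
  rw [key]
  have : ∑ y : ZMod p, (#{x : ZMod p | x ^ 3 = y ^ 3} : ℝ) ≤ ∑ y : ZMod p, (3 : ℝ) :=
    sum_le_sum fun y _ => by exact_mod_cast card_cube_eq_le _
  rw [sum_const, card_univ, ZMod.card, nsmul_eq_mul] at this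
  calc _ ≤ (p : ℝ) * (p * 3) := by gcongr
    _ = _ := by ring

lemma cubicExpSum_zero : cubicExpSum p 0 = p := by
  simp [cubicExpSum, ZMod.card]

lemma cubicExpSum_mul_cube (t : ZMod p) {c : ZMod p} (hc : c ≠ 0) :
    cubicExpSum p (t * c ^ 3) = cubicExpSum p t := by
  unfold cubicExpSum
  refine Fintype.sum_equiv (Equiv.mulLeft₀ c hc) _ _ fun x => ?_
  simp only [Equiv.mulLeft₀_apply]
  congr 1; ring

lemma normSq_cubicExpSum_le (h7 : 7 ≤ p) {t : ZMod p} (ht : t ≠ 0) :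
    Complex.normSq (cubicExpSum p t) ≤ 7 * p := by
  have h7' : (7 : ℝ) ≤ p := by exact_mod_cast h7
  have h1 : ∑ s ∈ univ.erase (0 : ZMod p), Complex.normSq (cubicExpSum p s)
      ≤ 2 * (p : ℝ) ^ 2 := by
    have h := sum_normSq_cubicExpSum_le (p := p)
    rw [← add_sum_erase _ _ (mem_univ (0 : ZMod p)), cubicExpSum_zero] at h
    simp only [Complex.normSq_natCast] at h
    linarith
  have h2 : ∑ c ∈ univ.erase (0 : ZMod p), Complex.normSq (cubicExpSum p (t * c ^ 3))
      = ((p : ℝ) - 1) * Complex.normSq (cubicExpSum p t) := by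
    rw [sum_congr rfl (g := fun _ => Complex.normSq (cubicExpSum p t))
      (fun c hc => by rw [cubicExpSum_mul_cube t (ne_of_mem_erase hc)]), sum_const,
      card_erase_of_mem (mem_univ _), card_univ, ZMod.card, nsmul_eq_mul,
      Nat.cast_sub hp.out.one_le, Nat.cast_one]
  have h3 : ∑ c ∈ univ.erase (0 : ZMod p), Complex.normSq (cubicExpSum p (t * c ^ 3))
      ≤ 3 * ∑ s ∈ univ.erase (0 : ZMod p), Complex.normSq (cubicExpSum p s) := by
    rw [← sum_fiberwise_of_maps_to (s := univ.erase (0 : ZMod p)) (t := univ.erase (0 : ZMod p))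
      (g := fun c => t * c ^ 3), mul_sum]
    · refine sum_le_sum fun s _ => ?_
      rw [sum_congr rfl (g := fun _ => Complex.normSq (cubicExpSum p s))
        (fun c hc => by rw [(mem_filter.1 hc).2]), sum_const, nsmul_eq_mul]
      refine mul_le_mul_of_nonneg_right ?_ (Complex.normSq_nonneg _)
      have : #{c ∈ univ.erase (0 : ZMod p) | t * c ^ 3 = s} ≤ #{c : ZMod p | c ^ 3 = s / t} := by
        refine card_le_card fun c hc => ?_
        simp only [mem_filter, mem_univ, true_and] at hc ⊢
        rw [← hc.2]; field_simp
      exact_mod_cast this.trans (card_cube_eq_le _)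
    · intro c hc
      simp only [mem_erase, mem_univ, and_true] at hc ⊢
      exact mul_ne_zero ht (pow_ne_zero _ hc)
  nlinarith

lemma natCast_mul_fourCubeCount (h : ZMod p) :
    ((p * fourCubeCount p h : ℝ) : ℂ)
      = ∑ t : ZMod p, cubicExpSum p t ^ 4 * ZMod.stdAddChar (-(t * h)) := by
  have h1 : ∀ t : ZMod p, cubicExpSum p t ^ 4 * ZMod.stdAddChar (-(t * h)) =
      ∑ x : ZMod p, ∑ y : ZMod p, ∑ z : ZMod p, ∑ w : ZMod p,
        (ZMod.stdAddChar (t * (x ^ 3 + y ^ 3 + z ^ 3 + w ^ 3 - h)) : ℂ) := by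
    intro t
    have : ∀ x y z w : ZMod p, (ZMod.stdAddChar (t * (x ^ 3 + y ^ 3 + z ^ 3 + w ^ 3 - h)) : ℂ)
        = ZMod.stdAddChar (t * x ^ 3) * (ZMod.stdAddChar (t * y ^ 3) *
          (ZMod.stdAddChar (t * z ^ 3) * (ZMod.stdAddChar (t * w ^ 3)
            * ZMod.stdAddChar (-(t * h))))) := by
      intro x y z w
      simp_rw [← AddChar.map_add_eq_mul]
      congr 1; ring
    simp_rw [this, ← mul_sum, ← sum_mul, cubicExpSum]
    ring
  simp_rw [h1]
  unfold fourCubeCount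
  push_cast
  rw [mul_sum, sum_comm]
  refine sum_congr rfl fun x _ => ?_
  rw [mul_sum, sum_comm]
  refine sum_congr rfl fun y _ => ?_
  rw [mul_sum, sum_comm]
  refine sum_congr rfl fun z _ => ?_
  rw [mul_sum, sum_comm]
  refine sum_congr rfl fun w _ => ?_
  rw [sum_stdAddChar_mul]
  simp only [sub_eq_zero]
  split_ifs <;> simp

lemma le_fourCubeCount (h7 : 7 ≤ p) {h : ZMod p} (hh : h ≠ 0) :
    (p : ℝ) ^ 3 - 196 * (p * √p) ≤ fourCubeCount p h := by
  have h7' : (7 : ℝ) ≤ p := by exact_mod_cast h7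
  have hp0 : (0 : ℝ) < p := by linarith
  have hnorm : ∀ t : ZMod p, t ≠ 0 → ‖cubicExpSum p t‖ ^ 2 ≤ 7 * p := fun t ht => by
    rw [← Complex.normSq_eq_norm_sq]; exact normSq_cubicExpSum_le h7 ht
  have hnorm1 : ∀ t : ZMod p, t ≠ 0 → ‖cubicExpSum p t‖ ≤ 3 * √p := fun t ht => by
    refine le_of_sq_le_sq ?_ (by positivity)
    rw [mul_pow, Real.sq_sqrt hp0.le]
    linarith [hnorm t ht]
  set D : ℂ := ∑ t ∈ univ.erase (0 : ZMod p), cubicExpSum p t ^ 4 * ZMod.stdAddChar (-(t * h))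
    with hD
  have h1 : ((p * fourCubeCount p h : ℝ) : ℂ) = (p : ℂ) ^ 4 + D := by
    rw [natCast_mul_fourCubeCount, ← add_sum_erase _ _ (mem_univ (0 : ZMod p)), cubicExpSum_zero]
    simp [hD]
  have h2 : ∀ c ∈ univ.erase (0 : ZMod p), D = ∑ t ∈ univ.erase (0 : ZMod p),
      cubicExpSum p t ^ 4 * ZMod.stdAddChar (-(t * h) * c ^ 3) := by
    intro c hc
    have hc0 := ne_of_mem_erase hc
    rw [hD]
    symm
    refine sum_equiv (Equiv.mulRight₀ (c ^ 3) (pow_ne_zero _ hc0)) ?_ ?_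
    · intro t
      simp [hc0]
    · intro t _
      simp only [Equiv.mulRight₀_apply]
      rw [cubicExpSum_mul_cube t hc0]
      congr 2; ring
  have h3 : ((p : ℂ) - 1) * D = ∑ t ∈ univ.erase (0 : ZMod p),
      cubicExpSum p t ^ 4 * (cubicExpSum p (-(t * h)) - 1) := by
    have h4 := sum_congr rfl h2
    rw [sum_const, card_erase_of_mem (mem_univ _), card_univ, ZMod.card, nsmul_eq_mul,
      Nat.cast_sub hp.out.one_le, Nat.cast_one, sum_comm] at h4
    rw [h4]
    refine sum_congr rfl fun t _ => ?_
    rw [← mul_sum]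
    congr 1
    rw [cubicExpSum, ← add_sum_erase _ _ (mem_univ (0 : ZMod p))]
    simp
  have h5 : ((p : ℝ) - 1) * ‖D‖ ≤ ((p : ℝ) - 1) * ((7 * p) ^ 2 * (3 * √p + 1)) := by
    have : ((p : ℝ) - 1) * ‖D‖ = ‖((p : ℂ) - 1) * D‖ := by
      rw [norm_mul]
      congr 1
      rw [← Complex.ofReal_natCast, ← Complex.ofReal_one, ← Complex.ofReal_sub,
        Complex.norm_real, Real.norm_of_nonneg (by linarith)]
    rw [this, h3]
    refine (norm_sum_le_of_le _ (f := fun t => cubicExpSum p t ^ 4 * (cubicExpSum p (-(t * h)) - 1))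
      (n := fun _ => (7 * (p : ℝ)) ^ 2 * (3 * √p + 1)) fun t ht => ?_).trans (le_of_eq ?_)
    · have ht0 := ne_of_mem_erase ht
      rw [norm_mul, norm_pow, show (4 : ℕ) = 2 * 2 from rfl, pow_mul]
      gcongr
      · exact hnorm t ht0
      · refine (norm_sub_le _ _).trans ?_
        rw [norm_one]
        gcongr
        exact hnorm1 _ (neg_ne_zero.2 (mul_ne_zero ht0 hh))
    · rw [sum_const, card_erase_of_mem (mem_univ _), card_univ, ZMod.card, nsmul_eq_mul,
        Nat.cast_sub hp.out.one_le, Nat.cast_one]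
  have h6 : ‖D‖ ≤ (7 * p) ^ 2 * (3 * √p + 1) := le_of_mul_le_mul_left h5 (by linarith)
  have h7 : p * fourCubeCount p h = (p : ℝ) ^ 4 + D.re := by
    have := congrArg Complex.re h1
    rw [Complex.ofReal_re, Complex.add_re] at this
    rw [this]
    congr 1
    norm_cast
  have h8 : -D.re ≤ ‖D‖ := (neg_le_abs _).trans (Complex.abs_re_le_norm D)
  have h9 : (1 : ℝ) ≤ √p := Real.one_le_sqrt.2 (by linarith)
  refine le_of_mul_le_mul_left ?_ hp0
  rw [h7]
  have : (7 * (p : ℝ)) ^ 2 * (3 * √p + 1) ≤ (7 * p) ^ 2 * (4 * √p) := by gcongr; linarith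
  nlinarith

lemma exists_cube_root_of_unity (h3 : p % 3 = 1) : ∃ ω : ZMod p, ω ≠ 1 ∧ ω ^ 3 = 1 := by
  have h : 3 ∣ Fintype.card (ZMod p)ˣ := by
    rw [ZMod.card_units]; omega
  obtain ⟨u, hu⟩ := exists_prime_orderOf_dvd_card 3 h
  refine ⟨u, fun h1 => ?_, ?_⟩
  · rw [Units.val_eq_one] at h1
    simp [h1] at hu
  · rw [← Units.val_pow_eq_pow_val, ← hu, pow_orderOf_eq_one, Units.val_one]

lemma three_le_card_cube_eq (h3 : p % 3 = 1) {y : ZMod p} (hy : y ≠ 0) :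
    3 ≤ #{x : ZMod p | x ^ 3 + y ^ 3 = 0} := by
  obtain ⟨ω, h1, hω⟩ := exists_cube_root_of_unity h3
  have h0 : ω ≠ 0 := by rintro rfl; simp at hω
  have h2 : ω ^ 2 ≠ 1 := fun h => h1 (by rw [← hω, pow_succ, h, one_mul])
  have hc : #({-y, -(ω * y), -(ω ^ 2 * y)} : Finset (ZMod p)) = 3 := by
    rw [card_eq_three]
    refine ⟨_, _, _, ?_, ?_, ?_, rfl⟩
    · simpa [hy, eq_comm] using h1
    · simpa [hy, eq_comm] using h2
    · simp only [ne_eq, neg_inj]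
      intro h
      refine h1 (mul_left_cancel₀ (mul_ne_zero h0 hy) ?_)
      linear_combination -h
  refine hc.symm.trans_le (card_le_card fun x hx => ?_)
  simp only [mem_insert, mem_singleton] at hx
  simp only [mem_filter, mem_univ, true_and]
  rcases hx with rfl | rfl | rfl
  · ring
  · linear_combination -(y ^ 3) * hω
  · linear_combination -(y ^ 3) * (ω ^ 3 + 1) * hω

lemma le_fourCubeCount_zero (h7 : 7 ≤ p) (h3 : p % 3 = 1) :
    (p : ℝ) ^ 3 + 2 * p ^ 2 ≤ fourCubeCount p 0 := by
  have h7' : (7 : ℝ) ≤ p := by exact_mod_cast h7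
  set T : ZMod p → ℝ := fun b => ∑ x : ZMod p, ∑ y : ZMod p,
    if x ^ 3 + y ^ 3 = b then 1 else 0 with hT
  have hTneg : ∀ b, T (-b) = T b := by
    intro b
    simp only [hT]
    refine Fintype.sum_equiv (Equiv.neg _) _ _ fun x => Fintype.sum_equiv (Equiv.neg _) _ _
      fun y => ?_
    simp only [Equiv.neg_apply]
    refine if_congr ?_ rfl rfl
    rw [← neg_inj]
    ring_nf
  have hR : fourCubeCount p 0 = ∑ b, T b ^ 2 := by
    have : ∀ b, T b ^ 2 = T b * T (-b) := fun b => by rw [hTneg, sq]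
    simp_rw [this]
    simp only [hT]
    simp_rw [sum_mul]
    rw [sum_comm]
    unfold fourCubeCount
    refine sum_congr rfl fun x _ => ?_
    rw [sum_comm (s := (univ : Finset (ZMod p))) (t := (univ : Finset (ZMod p)))
      (f := fun b y => (if x ^ 3 + y ^ 3 = b then (1 : ℝ) else 0) * _)]
    refine sum_congr rfl fun y _ => ?_
    simp_rw [ite_mul, one_mul, zero_mul]
    rw [sum_ite_eq]
    simp only [mem_univ, if_true]
    refine sum_congr rfl fun z _ => sum_congr rfl fun w _ => if_congr ?_ rfl rfl
    rw [eq_neg_iff_add_eq_zero]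
    ring_nf
  have hsum : ∑ b, T b = (p : ℝ) ^ 2 := by
    simp only [hT]
    rw [sum_comm]
    simp_rw [sum_comm (s := (univ : Finset (ZMod p))) (t := (univ : Finset (ZMod p)))
      (f := fun b y => if _ ^ 3 + y ^ 3 = b then (1 : ℝ) else 0)]
    simp [ZMod.card, sq]
  have h0 : 3 * ((p : ℝ) - 1) ≤ T 0 := by
    simp only [hT]
    rw [sum_comm]
    calc 3 * ((p : ℝ) - 1) = ∑ y ∈ univ.erase (0 : ZMod p), (3 : ℝ) := by
          rw [sum_const, card_erase_of_mem (mem_univ _), card_univ, ZMod.card, nsmul_eq_mul,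
            Nat.cast_sub hp.out.one_le, Nat.cast_one, mul_comm]
      _ ≤ ∑ y ∈ univ.erase (0 : ZMod p), ∑ x : ZMod p,
          if x ^ 3 + y ^ 3 = 0 then (1 : ℝ) else 0 := by
          refine sum_le_sum fun y hy => ?_
          rw [← sum_filter, sum_const, nsmul_one]
          exact_mod_cast three_le_card_cube_eq h3 (ne_of_mem_erase hy)
      _ ≤ _ := sum_le_sum_of_subset_of_nonneg (subset_univ _) fun _ _ _ =>
          sum_nonneg fun _ _ => by split_ifs <;> norm_num
  have hvar : ∑ b, (T b - p) ^ 2 = ∑ b, T b ^ 2 - (p : ℝ) ^ 3 := by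
    have : ∀ b, (T b - p) ^ 2 = T b ^ 2 - 2 * p * T b + (p : ℝ) ^ 2 := fun b => by ring
    simp_rw [this, sum_add_distrib, sum_sub_distrib, ← mul_sum, hsum]
    simp [ZMod.card]
    ring
  have hone : (T 0 - p) ^ 2 ≤ ∑ b, (T b - p) ^ 2 :=
    single_le_sum (f := fun b => (T b - p) ^ 2) (fun _ _ => sq_nonneg _) (mem_univ 0)
  rw [hR]
  nlinarith
end prime

/-- There is a probability weight on `ZMod Q` under which the expected number of solutions of
`x ^ 3 + y ^ 3 + z ^ 3 = a + (j + 1)` is at most `Q ^ 2 * u j`, for every `j`. -/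
def HasCubeWeight (Q : ℕ) (u : ℕ → ℝ) : Prop :=
  ∃ _ : NeZero Q, ∃ G : ZMod Q → ℝ, (∀ a, 0 ≤ G a) ∧ ∑ a, G a = 1 ∧
    ∀ j : ℕ, ∑ x : ZMod Q, ∑ y : ZMod Q, ∑ z : ZMod Q,
      G (x ^ 3 + y ^ 3 + z ^ 3 - (j + 1 : ℕ)) ≤ (Q : ℝ) ^ 2 * u j

lemma hasCubeWeight_one : HasCubeWeight 1 fun _ => 1 := by
  refine ⟨inferInstance, fun _ => 1, fun _ => zero_le_one, ?_, fun j => ?_⟩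
  · exact Fintype.sum_unique _
  · simp

lemma HasCubeWeight.mul {m n : ℕ} {u v : ℕ → ℝ} (hmn : m.Coprime n)
    (hm : HasCubeWeight m u) (hn : HasCubeWeight n v) :
    HasCubeWeight (m * n) fun j => u j * v j := by
  obtain ⟨_, G, hG0, hG1, hG⟩ := hm
  obtain ⟨_, H, hH0, hH1, hH⟩ := hn
  let e := ZMod.chineseRemainder hmn
  have hsum : ∀ (f : ZMod m → ℝ) (g : ZMod n → ℝ),
      ∑ a, f (e a).1 * g (e a).2 = (∑ a, f a) * ∑ b, g b := fun f g => by
    rw [Fintype.sum_equiv e.toEquiv (fun a => f (e a).1 * g (e a).2)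
      (fun a => f a.1 * g a.2) fun _ => rfl, Fintype.sum_prod_type, sum_mul_sum]
  refine ⟨inferInstance, fun a => G (e a).1 * H (e a).2,
    fun a => mul_nonneg (hG0 _) (hH0 _), ?_, fun j => ?_⟩
  · rw [hsum, hG1, hH1, one_mul]
  · simp only [map_sub, map_add, map_pow, map_natCast, Prod.fst_sub, Prod.snd_sub, Prod.fst_add,
      Prod.snd_add, Prod.pow_fst, Prod.pow_snd, Prod.fst_natCast, Prod.snd_natCast]
    have h1 : ∀ x y : ZMod (m * n),
        ∑ z : ZMod (m * n), G ((e x).1 ^ 3 + (e y).1 ^ 3 + (e z).1 ^ 3 - (j + 1 : ℕ)) *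
          H ((e x).2 ^ 3 + (e y).2 ^ 3 + (e z).2 ^ 3 - (j + 1 : ℕ)) =
        (∑ z, G ((e x).1 ^ 3 + (e y).1 ^ 3 + z ^ 3 - (j + 1 : ℕ))) *
          ∑ z, H ((e x).2 ^ 3 + (e y).2 ^ 3 + z ^ 3 - (j + 1 : ℕ)) := fun x y =>
      hsum (fun a => G (_ + a ^ 3 - _)) (fun b => H (_ + b ^ 3 - _))
    simp_rw [h1]
    have h2 : ∀ x : ZMod (m * n),
        ∑ y, (∑ z, G ((e x).1 ^ 3 + (e y).1 ^ 3 + z ^ 3 - (j + 1 : ℕ))) *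
          ∑ z, H ((e x).2 ^ 3 + (e y).2 ^ 3 + z ^ 3 - (j + 1 : ℕ)) =
        (∑ y, ∑ z, G ((e x).1 ^ 3 + y ^ 3 + z ^ 3 - (j + 1 : ℕ))) *
          ∑ y, ∑ z, H ((e x).2 ^ 3 + y ^ 3 + z ^ 3 - (j + 1 : ℕ)) := fun x =>
      hsum (fun a => ∑ z, G (_ + a ^ 3 + z ^ 3 - _)) (fun b => ∑ z, H (_ + b ^ 3 + z ^ 3 - _))
    simp_rw [h2]
    rw [hsum (fun a => ∑ y, ∑ z, G (a ^ 3 + y ^ 3 + z ^ 3 - (j + 1 : ℕ)))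
      (fun b => ∑ y, ∑ z, H (b ^ 3 + y ^ 3 + z ^ 3 - (j + 1 : ℕ)))]
    have hnn : ∀ f : ZMod n → ℝ, (∀ a, 0 ≤ f a) →
        0 ≤ ∑ x : ZMod n, ∑ y : ZMod n, ∑ z : ZMod n, f (x ^ 3 + y ^ 3 + z ^ 3 - (j + 1 : ℕ)) :=
      fun f hf => sum_nonneg fun _ _ => sum_nonneg fun _ _ => sum_nonneg fun _ _ => hf _
    have hnn' : 0 ≤ ∑ x : ZMod m, ∑ y : ZMod m, ∑ z : ZMod m,
        G (x ^ 3 + y ^ 3 + z ^ 3 - (j + 1 : ℕ)) :=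
      sum_nonneg fun _ _ => sum_nonneg fun _ _ => sum_nonneg fun _ _ => hG0 _
    refine (mul_le_mul (hG j) (hH j) (hnn H hH0) (hnn'.trans (hG j))).trans (le_of_eq ?_)
    push_cast
    ring

lemma hasCubeWeight_prod {P : Finset ℕ} (hP : ∀ p ∈ P, p.Prime) {u : ℕ → ℕ → ℝ}
    (hu : ∀ p ∈ P, HasCubeWeight p (u p)) :
    HasCubeWeight (∏ p ∈ P, p) fun j => ∏ p ∈ P, u p j := by
  induction P using Finset.induction_on with
  | empty => simpa using hasCubeWeight_one
  | insert p P hp ih =>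
    simp_rw [prod_insert hp]
    refine HasCubeWeight.mul ?_ (hu p (mem_insert_self _ _))
      (ih (fun q hq => hP q (mem_insert_of_mem hq)) fun q hq => hu q (mem_insert_of_mem hq))
    refine Nat.Coprime.prod_right fun q hq => ?_
    refine (Nat.coprime_primes (hP p (mem_insert_self _ _)) (hP q (mem_insert_of_mem hq))).2 ?_
    rintro rfl
    exact hp hq

lemma hasCubeWeight_prime {p : ℕ} (hp : p.Prime) (h3 : p % 3 = 1) {L : ℕ} (hL : 0 < L) :
    HasCubeWeight p fun j =>
      Real.exp (98 / (p * √p) - if j < L then 1 / ((L : ℝ) * p) else 0) := by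
  have : Fact p.Prime := ⟨hp⟩
  have h7 : 7 ≤ p := by
    by_contra! h
    have := hp.two_le
    interval_cases p <;> first | omega | (revert hp; decide)
  have h7' : (7 : ℝ) ≤ p := by exact_mod_cast h7
  have hp0 : (0 : ℝ) < p := by linarith
  have hL0 : (0 : ℝ) < L := by exact_mod_cast hL
  have hs0 : (0 : ℝ) < √p := Real.sqrt_pos.2 hp0
  let g : ℕ → ZMod p → ℝ := fun i a =>
    (3 - ∑ w : ZMod p, if w ^ 3 = -(a + (i + 1 : ℕ)) then 1 else 0) / (2 * p)
  have hg0 : ∀ i a, 0 ≤ g i a := by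
    intro i a
    refine div_nonneg (sub_nonneg.2 ?_) (by positivity)
    rw [sum_boole]
    exact_mod_cast card_cube_eq_le _
  have hg1 : ∀ i, ∑ a, g i a = 1 := by
    intro i
    have : ∑ a : ZMod p, ∑ w : ZMod p, (if w ^ 3 = -(a + (i + 1 : ℕ)) then (1 : ℝ) else 0) = p := by
      rw [sum_comm]
      have : ∀ w a : ZMod p, w ^ 3 = -(a + (i + 1 : ℕ)) ↔ -w ^ 3 - (i + 1 : ℕ) = a := by
        intro w a
        constructor
        · intro h; rw [h]; ring
        · rintro rfl; ring
      simp_rw [this]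
      simp [ZMod.card]
    simp only [g]
    rw [← sum_div, sum_sub_distrib, this, sum_const, card_univ, ZMod.card, nsmul_eq_mul]
    field_simp
    ring
  have hgE : ∀ i j : ℕ, ∑ x : ZMod p, ∑ y : ZMod p, ∑ z : ZMod p,
      g i (x ^ 3 + y ^ 3 + z ^ 3 - (j + 1 : ℕ))
      = (3 * (p : ℝ) ^ 3 - fourCubeCount p ((j : ZMod p) - i)) / (2 * p) := by
    intro i j
    simp only [g, ← sum_div, sum_sub_distrib]
    congr 2
    · simp [ZMod.card]
      ring
    · unfold fourCubeCount
      refine sum_congr rfl fun x _ => sum_congr rfl fun y _ => sum_congr rfl fun z _ =>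
        sum_congr rfl fun w _ => if_congr ?_ rfl rfl
      push_cast
      rw [← sub_eq_zero, ← sub_eq_zero (a := x ^ 3 + _ + _ + _)]
      ring_nf
  have hsq : √(p : ℝ) * √p = p := Real.mul_self_sqrt hp0.le
  have hdiag : ∀ i : ℕ, (3 * (p : ℝ) ^ 3 - fourCubeCount p ((i : ZMod p) - i)) / (2 * p)
      ≤ (p : ℝ) ^ 2 * (1 + 98 / (p * √p) - 1 / p) := by
    intro i
    rw [sub_self, div_le_iff₀ (by positivity)]
    have := le_fourCubeCount_zero h7 h3
    have h : (p : ℝ) ^ 2 * (1 + 98 / (p * √p) - 1 / p) * (2 * p)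
      = 2 * p ^ 3 - 2 * p ^ 2 + 196 * (p ^ 2 / √p) := by
      field_simp
      ring
    rw [h]
    have : 0 ≤ (p : ℝ) ^ 2 / √p := by positivity
    linarith
  have hall : ∀ i j : ℕ, (3 * (p : ℝ) ^ 3 - fourCubeCount p ((j : ZMod p) - i)) / (2 * p)
      ≤ (p : ℝ) ^ 2 * (1 + 98 / (p * √p)) := by
    intro i j
    have h : (p : ℝ) ^ 2 * (1 + 98 / (p * √p)) * (2 * p) = 2 * p ^ 3 + 196 * (p * √p) := by
      have : 98 / (p * √p) = 98 * √p / (p : ℝ) ^ 2 := by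
        rw [div_eq_div_iff (by positivity) (by positivity)]
        linear_combination (-98 * (p : ℝ)) * hsq
      rw [this]
      field_simp
      ring
    rw [div_le_iff₀ (by positivity), h]
    have h0 : 0 ≤ (p : ℝ) * √p := by positivity
    by_cases hij : (j : ZMod p) - i = 0
    · rw [hij]
      have := le_fourCubeCount_zero h7 h3
      nlinarith
    · have := le_fourCubeCount h7 hij
      linarith
  refine ⟨inferInstance, fun a => (∑ i ∈ range L, g i a) / L,
    fun a => div_nonneg (sum_nonneg fun i _ => hg0 i a) hL0.le, ?_, fun j => ?_⟩
  · rw [← sum_div, sum_comm, sum_congr rfl fun i _ => hg1 i]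
    simp [hL0.ne']
  · have h1 : ∑ x : ZMod p, ∑ y : ZMod p, ∑ z : ZMod p,
        (∑ i ∈ range L, g i (x ^ 3 + y ^ 3 + z ^ 3 - (j + 1 : ℕ))) / L
        = (∑ i ∈ range L, (3 * (p : ℝ) ^ 3 - fourCubeCount p ((j : ZMod p) - i)) / (2 * p)) / L := by
      simp_rw [← hgE, ← sum_div]
      congr 1
      symm
      rw [sum_comm]
      refine sum_congr rfl fun x _ => ?_
      rw [sum_comm]
      refine sum_congr rfl fun y _ => ?_
      rw [sum_comm]
    rw [h1, div_le_iff₀ hL0]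
    have h2 : ∑ i ∈ range L, (3 * (p : ℝ) ^ 3 - fourCubeCount p ((j : ZMod p) - i)) / (2 * p)
        ≤ ∑ i ∈ range L, ((p : ℝ) ^ 2 * (1 + 98 / (p * √p)) - if i = j then (p : ℝ) else 0) := by
      refine sum_le_sum fun i _ => ?_
      split_ifs with hij
      · subst hij
        refine (hdiag i).trans (le_of_eq ?_)
        field_simp
      · rw [sub_zero]; exact hall i j
    refine h2.trans ?_
    rw [sum_sub_distrib, sum_const, card_range, nsmul_eq_mul, sum_ite_eq' (range L) j]
    simp only [mem_range]
    have h3 := Real.add_one_le_exp (98 / (p * √p) - if j < L then 1 / ((L : ℝ) * p) else 0)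
    calc _ = (p : ℝ) ^ 2 * ((98 / (p * √p) - if j < L then 1 / ((L : ℝ) * p) else 0) + 1) * L := by
          split_ifs
          · field_simp
            ring
          · ring
      _ ≤ _ := by gcongr

lemma log_mul_rpow_neg_le {n : ℕ} (hn : 0 < n) {s : ℝ} (hs : 0 < s) :
    Real.log n / (n : ℝ) ^ s ≤ 1 / s := by
  have hn0 : (0 : ℝ) < n := by exact_mod_cast hn
  rw [div_le_div_iff₀ (Real.rpow_pos_of_pos hn0 s) hs]
  have h := Real.log_le_sub_one_of_pos (Real.rpow_pos_of_pos hn0 s)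
  rw [Real.log_rpow hn0] at h
  linarith

lemma not_summable_one_div_prime_mod_three :
    ¬ Summable fun n : ℕ => if n.Prime ∧ n % 3 = 1 then 1 / (n : ℝ) else 0 := by
  intro hS
  set f : ℕ → ℝ := fun n => if n.Prime ∧ n % 3 = 1 then 1 / (n : ℝ) else 0 with hf
  have hf0 : ∀ n, 0 ≤ f n := fun n => by simp only [hf]; split_ifs <;> positivity
  obtain ⟨C, hC⟩ := ArithmeticFunction.vonMangoldt.LSeries_residueClass_lower_bound
    (q := 3) (a := 1) isUnit_one
  have hnp := ArithmeticFunction.vonMangoldt.summable_residueClass_non_primes_div (q := 3) 1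
  set r := ArithmeticFunction.vonMangoldt.residueClass (1 : ZMod 3) with hr
  have hr0 : ∀ n, 0 ≤ r n := ArithmeticFunction.vonMangoldt.residueClass_nonneg _
  set D := ∑' n : ℕ, (if n.Prime then 0 else r n) / (n : ℝ) with hD
  obtain ⟨N, hN⟩ : ∃ N, ∑' n, f (n + N) < 1 / 4 := by
    have := tendsto_sum_nat_add f
    exact ((this.eventually (gt_mem_nhds (by norm_num : (0 : ℝ) < 1 / 4)))).exists
  set K := ∑ n ∈ range N, Real.log n with hK
  have hrp : ∀ n : ℕ, n.Prime → r n = if n % 3 = 1 then Real.log n else 0 := by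
    intro n hn
    have : (n : ZMod 3) = 1 ↔ n % 3 = 1 := by
      rw [← Nat.cast_one, ZMod.natCast_eq_natCast_iff]; rfl
    simp only [hr, ArithmeticFunction.vonMangoldt.residueClass, Set.indicator_apply]
    simp only [Set.mem_ofPred_eq, this, ArithmeticFunction.vonMangoldt_apply_prime hn]
  have bound : ∀ s ∈ Set.Ioc (0 : ℝ) 1, 1 / 2 / s - C ≤ D + K + 1 / 4 / s := by
    intro s hs
    have hs0 := hs.1
    have h1 := hC (x := 1 + s) ⟨by linarith, by linarith [hs.2]⟩
    have ht : ((Nat.totient 3 : ℕ) : ℝ)⁻¹ = 1 / 2 := by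
      rw [Nat.totient_prime Nat.prime_three]; norm_num
    rw [ht, add_sub_cancel_left] at h1
    refine h1.trans ?_
    have hlow : ∀ n : ℕ, r n / (n : ℝ) ^ (1 + s) ≤
        (if n.Prime then 0 else r n) / (n : ℝ) + (if n < N then Real.log n else 0)
          + (if n < N then 0 else f n) * (1 / s) := by
      intro n
      rcases Nat.eq_zero_or_pos n with rfl | hn
      · simp [hf, hr]
      have hn1 : (1 : ℝ) ≤ n := by exact_mod_cast hn
      have hn0 : (0 : ℝ) < n := by linarith
      have hlog : 0 ≤ Real.log n := Real.log_nonneg hn1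
      have hps : (1 : ℝ) ≤ (n : ℝ) ^ s := Real.one_le_rpow hn1 hs0.le
      have hps' : (n : ℝ) ≤ (n : ℝ) ^ (1 + s) := by
        rw [Real.rpow_add hn0, Real.rpow_one]; nlinarith
      by_cases hp : n.Prime
      · rw [if_pos hp, zero_div, zero_add, hrp n hp]
        by_cases h3 : n % 3 = 1
        · rw [if_pos h3]
          by_cases hnN : n < N
          · rw [if_pos hnN, if_pos hnN, zero_mul, add_zero]
            exact div_le_self hlog (hn1.trans hps')
          · rw [if_neg hnN, if_neg hnN, zero_add, Real.rpow_add hn0, Real.rpow_one]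
            simp only [hf, hp, h3, and_self, if_true]
            have := log_mul_rpow_neg_le hn hs0
            calc Real.log n / (n * (n : ℝ) ^ s) = 1 / n * (Real.log n / (n : ℝ) ^ s) := by
                  field_simp
              _ ≤ _ := by gcongr
        · rw [if_neg h3, zero_div]
          refine add_nonneg ?_ (mul_nonneg ?_ (by positivity))
          · split_ifs <;> simp [hlog]
          · split_ifs
            exacts [le_rfl, hf0 n]
      · rw [if_neg hp]
        have : r n / (n : ℝ) ^ (1 + s) ≤ r n / n := by gcongr; exact hr0 n
        refine this.trans (le_add_of_le_of_nonneg (le_add_of_nonneg_right ?_) ?_)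
        · split_ifs <;> simp [hlog]
        · refine mul_nonneg ?_ (by positivity)
          split_ifs
          exacts [le_rfl, hf0 n]
    have s2 : HasSum (fun n : ℕ => if n < N then Real.log n else 0) K := by
      have := hasSum_sum_of_ne_finset_zero (L := .unconditional ℕ)
        (f := fun n : ℕ => if n < N then Real.log n else 0)
        (s := range N) fun n hn => if_neg (by simpa using hn)
      convert this using 1
      exact sum_congr rfl fun n hn => (if_pos (mem_range.1 hn)).symm
    have s3 : HasSum (fun n : ℕ => if n < N then 0 else f n) (∑' n, f (n + N)) := by
      rw [← hasSum_nat_add_iff' N]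
      have hz : ∑ i ∈ range N, (if i < N then 0 else f i) = 0 :=
        sum_eq_zero fun n hn => if_pos (mem_range.1 hn)
      rw [hz, sub_zero]
      simpa using ((summable_nat_add_iff N).2 hS).hasSum
    have s4 := (hnp.hasSum.add s2).add (s3.mul_right (1 / s))
    have s1 : Summable fun n : ℕ => r n / (n : ℝ) ^ (1 + s) :=
      Summable.of_nonneg_of_le (fun n => div_nonneg (hr0 n) (by positivity)) hlow s4.summable
    refine (hasSum_le hlow s1.hasSum s4).trans ?_
    have : (∑' n, f (n + N)) * (1 / s) ≤ 1 / 4 * (1 / s) := by gcongr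
    calc _ ≤ D + K + 1 / 4 * (1 / s) := by linarith
      _ = _ := by ring
  set M := max 1 (4 * (C + D + K) + 1) with hM
  have hM1 : 1 ≤ M := le_max_left _ _
  have h := bound (1 / M) ⟨by positivity, by rw [div_le_one (by linarith)]; exact hM1⟩
  have hM2 : 4 * (C + D + K) + 1 ≤ M := le_max_right _ _
  rw [div_div_eq_mul_div, div_one, div_div_eq_mul_div, div_one] at h
  linarith

lemma exists_primes_sum_one_div_ge (H : ℝ) :
    ∃ P : Finset ℕ, (∀ p ∈ P, p.Prime ∧ p % 3 = 1) ∧ H ≤ ∑ p ∈ P, 1 / (p : ℝ) := by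
  by_contra! hcon
  refine not_summable_one_div_prime_mod_three ?_
  refine summable_of_sum_range_le (c := H) (fun n => by split_ifs <;> positivity) fun n => ?_
  rw [← sum_filter]
  exact (hcon _ fun p hp => (mem_filter.1 hp).2).le

lemma exists_hasCubeWeight_tsum_le {w : ℕ → ℝ} (hw0 : ∀ j, 0 ≤ w j) (hw : Summable w)
    {ε : ℝ} (hε : 0 < ε) :
    ∃ (Q : ℕ) (u : ℕ → ℝ), HasCubeWeight Q u ∧ Summable (fun j => w j * u j) ∧
      ∑' j, w j * u j ≤ ε := by
  have hδ0 : ∀ n : ℕ, 0 ≤ 98 / ((n : ℝ) * √n) := fun n => by positivity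
  have hδ : Summable fun n : ℕ => 98 / ((n : ℝ) * √n) := by
    have := (Real.summable_one_div_nat_rpow.2 (by norm_num : (1 : ℝ) < 3 / 2)).mul_left 98
    refine this.congr fun n => ?_
    rcases Nat.eq_zero_or_pos n with rfl | hn
    · simp
    have hn0 : (0 : ℝ) < n := by exact_mod_cast hn
    rw [show (3 / 2 : ℝ) = 1 + 1 / 2 by norm_num, Real.rpow_add hn0, Real.rpow_one,
      ← Real.sqrt_eq_rpow]
    ring
  set B := Real.exp (∑' n : ℕ, 98 / ((n : ℝ) * √n)) with hB
  have hB0 : 0 < B := Real.exp_pos _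
  obtain ⟨L, hLpos, hL⟩ : ∃ L : ℕ, 0 < L ∧ B * ∑' n, w (n + L) < ε / 2 := by
    have h1 := (tendsto_sum_nat_add w).const_mul B
    rw [mul_zero] at h1
    exact ((Filter.eventually_gt_atTop 0).and
      (h1.eventually (gt_mem_nhds (half_pos hε)))).exists
  obtain ⟨h, hh⟩ : ∃ h : ℝ, B * (∑' n, w n) * Real.exp (-h) < ε / 2 := by
    have h1 := Real.tendsto_exp_neg_atTop_nhds_zero.const_mul (B * ∑' n, w n)
    rw [mul_zero] at h1
    exact (h1.eventually (gt_mem_nhds (half_pos hε))).exists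
  obtain ⟨P, hP, hPH⟩ := exists_primes_sum_one_div_ge (L * h)
  have hL0 : (0 : ℝ) < L := by exact_mod_cast hLpos
  let u : ℕ → ℝ := fun j => ∏ p ∈ P,
    Real.exp (98 / (p * √p) - if j < L then 1 / ((L : ℝ) * p) else 0)
  have hu0 : ∀ j, 0 ≤ u j := fun j => prod_nonneg fun p _ => (Real.exp_pos _).le
  have hu : ∀ j, u j ≤ if j < L then B * Real.exp (-h) else B := by
    intro j
    have h1 : ∑ p ∈ P, 98 / ((p : ℝ) * √p) ≤ ∑' n : ℕ, 98 / ((n : ℝ) * √n) :=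
      hδ.sum_le_tsum _ fun n _ => hδ0 n
    simp only [u]
    rw [← Real.exp_sum, sum_sub_distrib]
    split_ifs
    · rw [hB, ← Real.exp_add]
      refine Real.exp_le_exp.2 ?_
      have h2 : h ≤ ∑ p ∈ P, 1 / ((L : ℝ) * p) := by
        have : ∑ p ∈ P, 1 / ((L : ℝ) * p) = (∑ p ∈ P, 1 / (p : ℝ)) / L := by
          rw [sum_div]
          refine sum_congr rfl fun p _ => ?_
          rw [div_div, mul_comm]
        rw [this, le_div_iff₀ hL0, mul_comm]
        exact hPH
      linarith
    · rw [sum_const_zero, sub_zero]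
      exact Real.exp_le_exp.2 h1
  have hbound : ∀ j, w j * u j ≤
      B * Real.exp (-h) * w j + (if j < L then 0 else B * w j) := by
    intro j
    have := mul_le_mul_of_nonneg_left (hu j) (hw0 j)
    refine this.trans ?_
    have := mul_nonneg (mul_nonneg hB0.le (Real.exp_pos (-h)).le) (hw0 j)
    split_ifs <;> linarith
  have s1 := hw.hasSum.mul_left (B * Real.exp (-h))
  have s2 : HasSum (fun j : ℕ => if j < L then 0 else B * w j) (B * ∑' n, w (n + L)) := by
    rw [← hasSum_nat_add_iff' L]
    have hz : ∑ i ∈ range L, (if i < L then 0 else B * w i) = 0 :=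
      sum_eq_zero fun n hn => if_pos (mem_range.1 hn)
    rw [hz, sub_zero]
    simpa using ((summable_nat_add_iff L).2 hw).hasSum.mul_left B
  have s3 : Summable fun j => w j * u j :=
    Summable.of_nonneg_of_le (fun j => mul_nonneg (hw0 j) (hu0 j)) hbound (s1.add s2).summable
  refine ⟨∏ p ∈ P, p, u, ?_, s3, ?_⟩
  · exact hasCubeWeight_prod (fun p hp => (hP p hp).1)
      (u := fun p j => Real.exp (98 / (p * √p) - if j < L then 1 / ((L : ℝ) * p) else 0))
      fun p hp => hasCubeWeight_prime (hP p hp).1 (hP p hp).2 hLpos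
  · refine (hasSum_le hbound s3.hasSum (s1.add s2)).trans ?_
    linarith

open Classical in
/-- The indicator function of the cubes. -/
noncomputable def cubeInd (m : ℕ) : ℕ := if ∃ n, n ^ 3 = m then 1 else 0

/-- The number of representations of `m` as an ordered sum of `k` cubes of natural numbers. -/
noncomputable def cubeReps : ℕ → ℕ → ℕ
  | 0, m => if m = 0 then 1 else 0
  | k + 1, m => ∑ ij ∈ antidiagonal m, cubeInd ij.1 * cubeReps k ij.2

lemma cubeInd_le_one (m : ℕ) : cubeInd m ≤ 1 := by
  unfold cubeInd; split_ifs <;> simp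

lemma cubeInd_cube (n : ℕ) : cubeInd (n ^ 3) = 1 := if_pos ⟨n, rfl⟩

lemma cubeReps_le_succ (k m : ℕ) : cubeReps k m ≤ cubeReps (k + 1) m := by
  rw [cubeReps]
  have h := single_le_sum (f := fun ij : ℕ × ℕ => cubeInd ij.1 * cubeReps k ij.2)
    (fun _ _ => Nat.zero_le _) (show ((0 : ℕ), m) ∈ antidiagonal m by simp)
  have h0 : cubeInd 0 = 1 := cubeInd_cube 0
  simpa [h0] using h

lemma cubeReps_le_pow (k m : ℕ) : cubeReps k m ≤ (m + 1) ^ k := by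
  induction k generalizing m with
  | zero => rw [cubeReps]; split_ifs <;> simp
  | succ k ih =>
    rw [cubeReps]
    calc _ ≤ ∑ ij ∈ antidiagonal m, (m + 1) ^ k := by
          refine sum_le_sum fun ij hij => ?_
          have h2 : ij.2 ≤ m := by
            have := HasAntidiagonal.mem_antidiagonal.1 hij
            omega
          calc _ ≤ 1 * (ij.2 + 1) ^ k := Nat.mul_le_mul (cubeInd_le_one _) (ih _)
            _ ≤ _ := by rw [one_mul]; gcongr
      _ = _ := by rw [sum_const, Nat.card_antidiagonal, smul_eq_mul, pow_succ']

lemma cubeReps_three_pos (x y z : ℕ) : 0 < cubeReps 3 (x ^ 3 + y ^ 3 + z ^ 3) := by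
  have h0 : cubeReps 0 0 = 1 := by rw [cubeReps]; simp
  have step : ∀ k n m : ℕ, 0 < cubeReps k m → 0 < cubeReps (k + 1) (n ^ 3 + m) := by
    intro k n m h
    rw [cubeReps]
    have h1 := single_le_sum (f := fun ij : ℕ × ℕ => cubeInd ij.1 * cubeReps k ij.2)
      (fun _ _ => Nat.zero_le _) (show (n ^ 3, m) ∈ antidiagonal (n ^ 3 + m) by simp)
    simp only [cubeInd_cube, one_mul] at h1
    exact h.trans_le h1
  have := step 2 x _ (step 1 y _ (step 0 z 0 (by rw [h0]; exact one_pos)))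
  rwa [add_zero, ← add_assoc] at this

lemma sum_mul_cubeReps_succ_le (k : ℕ) {F : ℕ → ℝ} (hF : ∀ m, 0 ≤ F m) {N Y : ℕ}
    (hN : N ≤ Y ^ 3) :
    ∑ m ∈ range N, F m * cubeReps (k + 1) m
      ≤ ∑ x ∈ range Y, ∑ m ∈ range N, F (x ^ 3 + m) * cubeReps k m := by
  classical
  have h1 : ∀ m ∈ range N, F m * cubeReps (k + 1) m ≤
      ∑ x ∈ range Y, ∑ l ∈ range N, if x ^ 3 + l = m then F (x ^ 3 + l) * cubeReps k l else 0 := by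
    intro m hm
    have hmN := mem_range.1 hm
    rw [cubeReps]
    push_cast
    rw [mul_sum, ← sum_product']
    have h2 : ∑ ij ∈ antidiagonal m, F m * ((cubeInd ij.1 : ℝ) * cubeReps k ij.2)
        = ∑ ij ∈ (antidiagonal m).filter fun ij => ∃ n, n ^ 3 = ij.1, F m * cubeReps k ij.2 := by
      rw [sum_filter]
      refine sum_congr rfl fun ij _ => ?_
      unfold cubeInd
      split_ifs <;> simp
    rw [h2, ← sum_filter]
    have h3 : ∑ ij ∈ (antidiagonal m).filter (fun ij => ∃ n, n ^ 3 = ij.1), F m * cubeReps k ij.2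
        ≤ ∑ ij ∈ ((range Y ×ˢ range N).filter fun a => a.1 ^ 3 + a.2 = m).image
            fun a => (a.1 ^ 3, a.2), F m * cubeReps k ij.2 := by
      refine sum_le_sum_of_subset_of_nonneg ?_ fun _ _ _ => mul_nonneg (hF _) (Nat.cast_nonneg _)
      intro ij hij
      obtain ⟨h4, n, hn⟩ := mem_filter.1 hij
      rw [HasAntidiagonal.mem_antidiagonal] at h4
      refine mem_image.2 ⟨(n, ij.2), mem_filter.2 ⟨mem_product.2 ⟨mem_range.2 ?_,
        mem_range.2 (by omega)⟩, by simp only [hn, h4]⟩, by simp [hn]⟩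
      refine lt_of_pow_lt_pow_left₀ 3 (Nat.zero_le _) ?_
      simp only
      omega
    refine h3.trans (le_of_eq ?_)
    rw [sum_image]
    · refine sum_congr rfl fun a ha => ?_
      rw [(mem_filter.1 ha).2]
    · intro a _ b _ hab
      simp only [Prod.mk.injEq] at hab
      exact Prod.ext (Nat.pow_left_injective (by norm_num) hab.1) hab.2
  refine (sum_le_sum h1).trans ?_
  rw [sum_comm]
  refine sum_le_sum fun x _ => ?_
  rw [sum_comm]
  refine sum_le_sum fun l _ => ?_
  rw [sum_ite_eq]
  split_ifs
  · exact le_rfl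
  · exact mul_nonneg (hF _) (Nat.cast_nonneg _)

lemma sum_mul_cubeReps_zero_le {F : ℕ → ℝ} (hF : ∀ m, 0 ≤ F m) (N : ℕ) :
    ∑ m ∈ range N, F m * cubeReps 0 m ≤ F 0 := by
  have : ∀ m, F m * cubeReps 0 m = if m = 0 then F 0 else 0 := by
    intro m
    rw [cubeReps]
    split_ifs with h <;> simp [h]
  simp_rw [this]
  rw [sum_ite_eq']
  split_ifs
  exacts [le_rfl, hF 0]

lemma sum_mul_cubeReps_two_le {F : ℕ → ℝ} (hF : ∀ m, 0 ≤ F m) {N Y : ℕ} (hN : N ≤ Y ^ 3) :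
    ∑ m ∈ range N, F m * cubeReps 2 m
      ≤ ∑ x ∈ range Y, ∑ y ∈ range Y, F (x ^ 3 + y ^ 3) := by
  refine (sum_mul_cubeReps_succ_le 1 hF hN).trans (sum_le_sum fun x _ => ?_)
  refine (sum_mul_cubeReps_succ_le 0 (fun m => hF (x ^ 3 + m)) hN).trans
    (sum_le_sum fun y _ => ?_)
  exact sum_mul_cubeReps_zero_le (fun m => hF (x ^ 3 + (y ^ 3 + m))) N

lemma sum_mul_cubeReps_three_le {F : ℕ → ℝ} (hF : ∀ m, 0 ≤ F m) {N Y : ℕ} (hN : N ≤ Y ^ 3) :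
    ∑ m ∈ range N, F m * cubeReps 3 m
      ≤ ∑ x ∈ range Y, ∑ y ∈ range Y, ∑ z ∈ range Y, F (x ^ 3 + (y ^ 3 + z ^ 3)) :=
  (sum_mul_cubeReps_succ_le 2 hF hN).trans
    (sum_le_sum fun x _ => sum_mul_cubeReps_two_le (fun m => hF (x ^ 3 + m)) hN)

lemma sum_mul_cubeReps_shift_le (k : ℕ) {F : ℤ → ℝ} (hF : ∀ m, 0 ≤ F m) (Y j : ℕ) :
    ∑ M ∈ range (Y ^ 3), F M * cubeReps k (M + 1 + j)
      ≤ ∑ m ∈ range ((Y + j + 1) ^ 3), F (m - (j + 1 : ℕ)) * cubeReps k m := by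
  have hinj : Set.InjOn (fun M => M + 1 + j) (range (Y ^ 3) : Set ℕ) := fun a _ b _ h => by
    simp only at h
    omega
  have h := sum_image (f := fun m : ℕ => F (m - (j + 1 : ℕ)) * cubeReps k m) hinj
  have h1 : ∀ M : ℕ, ((M + 1 + j : ℕ) : ℤ) - (j + 1 : ℕ) = M := fun M => by push_cast; ring
  simp only [h1] at h
  rw [← h]
  refine sum_le_sum_of_subset_of_nonneg ?_ fun _ _ _ => mul_nonneg (hF _) (Nat.cast_nonneg _)
  intro m hm
  obtain ⟨M, hM, rfl⟩ := mem_image.1 hm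
  rw [mem_range] at hM ⊢
  have : (Y + j + 1) ^ 3 = Y ^ 3 + (j + 1) + (3 * Y ^ 2 * (j + 1) + 3 * Y * (j + 1) ^ 2
    + (j ^ 3 + 3 * j ^ 2 + 2 * j)) := by ring
  omega

section series
variable {q : ℕ}

lemma summable_cubeReps_div (hq : 2 ≤ q) (k : ℕ) :
    Summable fun m : ℕ => (cubeReps k m : ℝ) / (q : ℝ) ^ m := by
  have hq' : (2 : ℝ) ≤ q := by exact_mod_cast hq
  have h1 := summable_pow_mul_geometric_of_norm_lt_one k (r := (1 / q : ℝ)) (by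
    rw [Real.norm_of_nonneg (by positivity), div_lt_one (by linarith)]; linarith)
  have h2 := ((summable_nat_add_iff 1).2 h1).mul_left (q : ℝ)
  refine Summable.of_nonneg_of_le (fun m => by positivity) (fun m => ?_) h2
  have : (cubeReps k m : ℝ) ≤ ((m + 1 : ℕ) : ℝ) ^ k := by exact_mod_cast cubeReps_le_pow k m
  calc _ ≤ ((m + 1 : ℕ) : ℝ) ^ k / (q : ℝ) ^ m := by gcongr
    _ = _ := by
      rw [one_div, inv_pow, pow_succ]
      field_simp

lemma hasSum_cubeInd_div (hq : 2 ≤ q) :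
    Summable (fun m : ℕ => (cubeInd m : ℝ) / (q : ℝ) ^ m) ∧
      ∑' m : ℕ, (cubeInd m : ℝ) / (q : ℝ) ^ m = theta3 q := by
  constructor
  · have h := summable_cubeReps_div hq 1
    refine h.of_nonneg_of_le (fun m => by positivity) fun m => ?_
    gcongr
    rw [cubeReps]
    have h := single_le_sum (f := fun ij : ℕ × ℕ => cubeInd ij.1 * cubeReps 0 ij.2)
      (fun _ _ => Nat.zero_le _) (show (m, (0 : ℕ)) ∈ antidiagonal m by simp)
    have h0 : cubeReps 0 0 = 1 := by rw [cubeReps]; simp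
    simpa only [h0, mul_one] using h
  · have hinj : Function.Injective fun n : ℕ => n ^ 3 := Nat.pow_left_injective (by norm_num)
    rw [← hinj.tsum_eq, theta3]
    · simp only [cubeInd_cube, Nat.cast_one]
    · intro m hm
      rw [Function.mem_support] at hm
      by_contra hcon
      refine hm ?_
      have : cubeInd m = 0 := if_neg fun ⟨n, hn⟩ => hcon ⟨n, hn⟩
      rw [this, Nat.cast_zero, zero_div]

lemma tsum_cubeReps_div (hq : 2 ≤ q) (k : ℕ) :
    ∑' m : ℕ, (cubeReps k m : ℝ) / (q : ℝ) ^ m = theta3 q ^ k := by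
  induction k with
  | zero =>
    rw [tsum_eq_single 0]
    · rw [cubeReps]; simp
    · intro m hm
      rw [cubeReps]; simp [hm]
  | succ k ih =>
    rw [pow_succ', ← ih, ← (hasSum_cubeInd_div hq).2,
      tsum_mul_tsum_eq_tsum_sum_antidiagonal_of_summable_norm
        (hasSum_cubeInd_div hq).1.norm (summable_cubeReps_div hq k).norm]
    refine tsum_congr fun m => ?_
    rw [cubeReps]
    push_cast
    rw [sum_div]
    refine sum_congr rfl fun ij hij => ?_
    rw [← HasAntidiagonal.mem_antidiagonal.1 hij, pow_add, mul_div_mul_comm]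

/-- The tail of the `q`-expansion of `theta3 q ^ k` after `M` digits, rescaled by `q ^ M`. -/
noncomputable def cubeTail (q k M : ℕ) : ℝ :=
  ∑' j : ℕ, (cubeReps k (M + 1 + j) : ℝ) / (q : ℝ) ^ (j + 1)

lemma summable_cubeTail (hq : 2 ≤ q) (k M : ℕ) :
    Summable fun j : ℕ => (cubeReps k (M + 1 + j) : ℝ) / (q : ℝ) ^ (j + 1) := by
  have hq0 : (q : ℝ) ≠ 0 := by positivity
  have := ((summable_nat_add_iff (M + 1)).2 (summable_cubeReps_div hq k)).mul_left ((q : ℝ) ^ M)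
  refine this.congr fun j => ?_
  rw [show j + (M + 1) = M + 1 + j by ring, show M + 1 + j = M + (j + 1) by ring, pow_add]
  field_simp

lemma cubeTail_nonneg (q k M : ℕ) : 0 ≤ cubeTail q k M :=
  tsum_nonneg fun _ => by positivity

lemma cubeTail_le_succ (hq : 2 ≤ q) (k M : ℕ) : cubeTail q k M ≤ cubeTail q (k + 1) M := by
  refine Summable.tsum_le_tsum (fun j => ?_) (summable_cubeTail hq k M)
    (summable_cubeTail hq (k + 1) M)
  have := cubeReps_le_succ k (M + 1 + j)
  gcongr

lemma cubeTail_eq (hq : 2 ≤ q) (k M : ℕ) :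
    cubeTail q k M = (cubeReps k (M + 1) + cubeTail q k (M + 1)) / q := by
  have hq0 : (q : ℝ) ≠ 0 := by positivity
  rw [cubeTail, (summable_cubeTail hq k M).tsum_eq_zero_add, cubeTail, add_div, ← tsum_div_const]
  congr 1
  · simp
  · refine tsum_congr fun j => ?_
    rw [show M + 1 + 1 + j = M + 1 + (j + 1) by ring, pow_succ (q : ℝ) (j + 1), div_div]

lemma exists_int_pow_mul_theta3_pow (hq : 2 ≤ q) (k M : ℕ) :
    ∃ n : ℤ, (q : ℝ) ^ M * theta3 q ^ k = n + cubeTail q k M := by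
  have hq0 : (q : ℝ) ≠ 0 := by positivity
  refine ⟨∑ m ∈ range (M + 1), cubeReps k m * q ^ (M - m), ?_⟩
  rw [← tsum_cubeReps_div hq, ← (summable_cubeReps_div hq k).sum_add_tsum_nat_add (M + 1),
    mul_add, mul_sum, ← tsum_mul_left, cubeTail]
  push_cast
  congr 1
  · refine sum_congr rfl fun m hm => ?_
    have hm' : m ≤ M := by rw [mem_range] at hm; omega
    rw [pow_sub₀ _ hq0 hm']
    field_simp
  · refine tsum_congr fun j => ?_
    rw [show j + (M + 1) = M + 1 + j by ring, show M + 1 + j = M + (j + 1) by ring, pow_add]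
    field_simp

lemma sum_mul_cubeTail_le (hq : 2 ≤ q) (k N : ℕ) (F : ℕ → ℝ) {b : ℕ → ℝ}
    (hb : ∀ j, ∑ M ∈ range N, F M * cubeReps k (M + 1 + j) ≤ b j) (hF : ∀ M, 0 ≤ F M)
    (hs : Summable fun j => b j / (2 : ℝ) ^ (j + 1)) :
    ∑ M ∈ range N, F M * cubeTail q k M ≤ ∑' j, b j / (2 : ℝ) ^ (j + 1) := by
  have hq' : (2 : ℝ) ≤ q := by exact_mod_cast hq
  have h1 : HasSum (fun j : ℕ => ∑ M ∈ range N, F M *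
      ((cubeReps k (M + 1 + j) : ℝ) / (q : ℝ) ^ (j + 1))) (∑ M ∈ range N, F M * cubeTail q k M) :=
    hasSum_sum fun M _ => (summable_cubeTail hq k M).hasSum.mul_left (F M)
  refine hasSum_le (fun j => ?_) h1 hs.hasSum
  simp_rw [← mul_div_assoc]
  rw [← sum_div]
  refine div_le_div₀ ?_ (hb j) (by positivity) (by gcongr)
  exact (sum_nonneg fun M _ => mul_nonneg (hF M) (Nat.cast_nonneg _)).trans (hb j)

end series

section relation
variable {q : ℕ}

/-- The integral combination of the tails of `theta3 q`, `theta3 q ^ 2` and `theta3 q ^ 3`. -/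
noncomputable def tailComb (q : ℕ) (c₁ c₂ c₃ : ℤ) (M : ℕ) : ℝ :=
  c₁ * cubeTail q 1 M + c₂ * cubeTail q 2 M + c₃ * cubeTail q 3 M

lemma exists_int_eq_tailComb (hq : 2 ≤ q) {c₀ c₁ c₂ c₃ : ℤ}
    (h : c₀ + c₁ * theta3 q + c₂ * theta3 q ^ 2 + c₃ * theta3 q ^ 3 = 0) (M : ℕ) :
    ∃ n : ℤ, tailComb q c₁ c₂ c₃ M = n := by
  obtain ⟨n₁, h₁⟩ := exists_int_pow_mul_theta3_pow hq 1 M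
  obtain ⟨n₂, h₂⟩ := exists_int_pow_mul_theta3_pow hq 2 M
  obtain ⟨n₃, h₃⟩ := exists_int_pow_mul_theta3_pow hq 3 M
  refine ⟨-(c₀ * q ^ M + c₁ * n₁ + c₂ * n₂ + c₃ * n₃), ?_⟩
  push_cast
  rw [tailComb]
  linear_combination (q : ℝ) ^ M * h - c₁ * h₁ - c₂ * h₂ - c₃ * h₃

lemma abs_tailComb_le (hq : 2 ≤ q) (c₁ c₂ c₃ : ℤ) (M : ℕ) :
    |tailComb q c₁ c₂ c₃ M| ≤ (|(c₁ : ℝ)| + |(c₂ : ℝ)| + |(c₃ : ℝ)|) * cubeTail q 3 M := by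
  have h1 := cubeTail_le_succ hq 1 M
  have h2 := cubeTail_le_succ hq 2 M
  have h0 := cubeTail_nonneg q 1 M
  have h3 : ∀ (c : ℝ) {t : ℝ}, 0 ≤ t → t ≤ cubeTail q 3 M → |c * t| ≤ |c| * cubeTail q 3 M := by
    intro c t ht h
    rw [abs_mul, abs_of_nonneg ht]
    gcongr
  rw [tailComb, add_mul, add_mul]
  refine (abs_add_three _ _ _).trans ?_
  exact add_le_add_three (h3 _ h0 (h1.trans h2)) (h3 _ (h0.trans h1) h2)
    (h3 _ (h0.trans (h1.trans h2)) le_rfl)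

lemma le_cubeTail_two_of_cubeReps_pos (hq : 2 ≤ q) {c₁ c₂ c₃ : ℤ} (hc : 1 ≤ c₃) {M : ℕ}
    (hM : tailComb q c₁ c₂ c₃ M = 0) (hi : 0 < cubeReps 3 (M + 1)) :
    1 / ((|(c₁ : ℝ)| + |(c₂ : ℝ)| + |(c₃ : ℝ)|) * q) ≤ cubeTail q 2 M := by
  have hq0 : (0 : ℝ) < q := by positivity
  have hc' : (1 : ℝ) ≤ c₃ := by exact_mod_cast hc
  set C := |(c₁ : ℝ)| + |(c₂ : ℝ)| + |(c₃ : ℝ)| with hC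
  have hC1 : 1 ≤ C := by
    rw [hC, abs_of_nonneg (zero_le_one.trans hc')]
    linarith [abs_nonneg (c₁ : ℝ), abs_nonneg (c₂ : ℝ)]
  have e1 := cubeTail_eq hq 1 M
  have e2 := cubeTail_eq hq 2 M
  have e3 := cubeTail_eq hq 3 M
  have n1 := cubeTail_nonneg q 1 (M + 1)
  have n2 := cubeTail_nonneg q 2 (M + 1)
  have n3 := cubeTail_nonneg q 3 (M + 1)
  have l1 := cubeTail_le_succ hq 1 (M + 1)
  have key : 1 / C ≤ cubeReps 2 (M + 1) + cubeTail q 2 (M + 1) := by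
    rcases Nat.eq_zero_or_pos (cubeReps 2 (M + 1)) with h2 | h2
    · have h1 : cubeReps 1 (M + 1) = 0 := by
        have : cubeReps 1 (M + 1) ≤ cubeReps 2 (M + 1) := cubeReps_le_succ 1 (M + 1)
        omega
      have h3 : (1 : ℝ) ≤ cubeReps 3 (M + 1) := by exact_mod_cast hi
      rw [tailComb, e1, e2, e3, h1, h2] at hM
      have hM' : c₁ * cubeTail q 1 (M + 1) + c₂ * cubeTail q 2 (M + 1)
          + c₃ * (cubeReps 3 (M + 1) + cubeTail q 3 (M + 1)) = 0 := by
        field_simp at hM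
        push_cast at hM
        linarith
      rw [h2, Nat.cast_zero, zero_add, div_le_iff₀ (by linarith)]
      have b1 : -(|(c₁ : ℝ)| * cubeTail q 2 (M + 1)) ≤ c₁ * cubeTail q 1 (M + 1) := by
        have : |(c₁ : ℝ)| * cubeTail q 1 (M + 1) ≤ |(c₁ : ℝ)| * cubeTail q 2 (M + 1) := by gcongr
        nlinarith [neg_abs_le (c₁ : ℝ)]
      have b2 : -(|(c₂ : ℝ)| * cubeTail q 2 (M + 1)) ≤ c₂ * cubeTail q 2 (M + 1) := by
        nlinarith [neg_abs_le (c₂ : ℝ)]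
      have b3 : 1 ≤ c₃ * (cubeReps 3 (M + 1) + cubeTail q 3 (M + 1)) := by nlinarith
      have b4 : 0 ≤ |(c₃ : ℝ)| * cubeTail q 2 (M + 1) := by positivity
      rw [hC]
      linarith
    · have h2' : (1 : ℝ) ≤ cubeReps 2 (M + 1) := by exact_mod_cast h2
      have : 1 / C ≤ 1 := by rw [div_le_one (by linarith)]; exact hC1
      linarith
  rw [e2, ← div_div]
  gcongr

lemma exists_le_cubeTail_two (hq : 2 ≤ q) {c₁ c₂ c₃ : ℤ} (hc : 1 ≤ c₃) {M i : ℕ}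
    (hM : tailComb q c₁ c₂ c₃ M = 0) (hi : 0 < cubeReps 3 (M + 1 + i)) :
    ∃ b, M ≤ b ∧ b ≤ M + i ∧
      1 / ((|(c₁ : ℝ)| + |(c₂ : ℝ)| + |(c₃ : ℝ)|) * q) ≤ cubeTail q 2 b := by
  induction i generalizing M with
  | zero => exact ⟨M, le_rfl, le_rfl, le_cubeTail_two_of_cubeReps_pos hq hc hM hi⟩
  | succ i ih =>
    rcases Nat.eq_zero_or_pos (cubeReps 3 (M + 1)) with h3 | h3
    · have h2 : cubeReps 2 (M + 1) = 0 := by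
        have : cubeReps 2 (M + 1) ≤ cubeReps 3 (M + 1) := cubeReps_le_succ 2 (M + 1)
        omega
      have h1 : cubeReps 1 (M + 1) = 0 := by
        have : cubeReps 1 (M + 1) ≤ cubeReps 2 (M + 1) := cubeReps_le_succ 1 (M + 1)
        omega
      have hM' : tailComb q c₁ c₂ c₃ (M + 1) = 0 := by
        rw [tailComb, cubeTail_eq hq, cubeTail_eq hq 2, cubeTail_eq hq 3, h1, h2, h3] at hM
        have hq0 : (0 : ℝ) < q := by positivity
        field_simp at hM
        rw [tailComb]
        push_cast at hM
        linarith
      obtain ⟨b, hb1, hb2, hb3⟩ := ih hM' (by rwa [show M + 1 + 1 + i = M + 1 + (i + 1) by ring])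
      exact ⟨b, by omega, by omega, hb3⟩
    · exact ⟨M, le_rfl, by omega, le_cubeTail_two_of_cubeReps_pos hq hc hM h3⟩

end relation

section counting
variable {q : ℕ}

lemma summable_add_two_pow_div (k : ℕ) :
    Summable fun j : ℕ => ((j : ℝ) + 2) ^ k / (2 : ℝ) ^ (j + 1) := by
  have h1 := summable_pow_mul_geometric_of_norm_lt_one k (r := (1 / 2 : ℝ)) (by norm_num)
  refine (((summable_nat_add_iff 2).2 h1).mul_left 2).congr fun j => ?_
  push_cast
  rw [one_div, inv_pow, pow_add (2 : ℝ) j 2, pow_succ (2 : ℝ) j]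
  field_simp

lemma exists_sum_cubeTail_two_le :
    ∃ K : ℝ, 0 < K ∧ ∀ q Y : ℕ, 2 ≤ q → 1 ≤ Y →
      ∑ b ∈ range (Y ^ 3), cubeTail q 2 b ≤ K * (Y : ℝ) ^ 2 := by
  refine ⟨∑' j : ℕ, ((j : ℝ) + 2) ^ 2 / (2 : ℝ) ^ (j + 1),
    (summable_add_two_pow_div 2).tsum_pos (fun j => by positivity) 0 (by positivity), ?_⟩
  intro q Y hq hY
  have hY' : (1 : ℝ) ≤ Y := by exact_mod_cast hY
  have h := sum_mul_cubeTail_le hq 2 (Y ^ 3) (fun _ => 1)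
    (b := fun j => (Y : ℝ) ^ 2 * ((j : ℝ) + 2) ^ 2) ?_ (fun _ => zero_le_one) ?_
  · simp only [one_mul] at h
    refine h.trans (le_of_eq ?_)
    rw [mul_comm, ← tsum_mul_left]
    exact tsum_congr fun j => mul_div_assoc _ _ _
  · intro j
    refine (sum_mul_cubeReps_shift_le 2 (F := fun _ => 1) (fun _ => zero_le_one) Y j).trans ?_
    refine (sum_mul_cubeReps_two_le (fun _ => zero_le_one) le_rfl).trans ?_
    simp only [sum_const, card_range, nsmul_eq_mul, mul_one]
    push_cast
    rw [← sq, ← mul_pow]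
    have : (Y : ℝ) + j + 1 ≤ Y * (j + 2) := by
      nlinarith [mul_nonneg (sub_nonneg.2 hY') (Nat.cast_nonneg (α := ℝ) j)]
    gcongr
  · refine ((summable_add_two_pow_div 2).mul_left ((Y : ℝ) ^ 2)).congr fun j => ?_
    rw [mul_div_assoc]

lemma sum_range_mul_zmod {Q : ℕ} [NeZero Q] (n : ℕ) (f : ZMod Q → ℝ) :
    ∑ x ∈ range (Q * n), f x = n * ∑ a, f a := by
  induction n with
  | zero => simp
  | succ n ih =>
    rw [Nat.mul_succ, sum_range_add, ih]
    push_cast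
    rw [add_mul, one_mul]
    congr 1
    have : ∑ x ∈ range Q, f (((Q * n : ℕ) : ZMod Q) + (x : ZMod Q)) = ∑ a, f a := by
      simp only [Nat.cast_mul, ZMod.natCast_self, zero_mul, zero_add]
      refine sum_bij' (fun x _ => (x : ZMod Q)) (fun a _ => a.val) (fun _ _ => mem_univ _)
        (fun a _ => mem_range.2 (ZMod.val_lt a)) ?_ ?_ ?_
      · intro x hx
        exact ZMod.val_cast_of_lt (mem_range.1 hx)
      · intro a _
        exact ZMod.natCast_zmod_val a
      · intro x _
        rfl
    simpa using this

lemma sum_weight_mul_cubeTail_three_le (hq : 2 ≤ q) {Q : ℕ} [NeZero Q] {G : ZMod Q → ℝ}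
    (hG : ∀ a, 0 ≤ G a) {u : ℕ → ℝ}
    (hu : ∀ j : ℕ, ∑ x : ZMod Q, ∑ y : ZMod Q, ∑ z : ZMod Q,
      G (x ^ 3 + y ^ 3 + z ^ 3 - (j + 1 : ℕ)) ≤ (Q : ℝ) ^ 2 * u j)
    (hs : Summable fun j : ℕ => ((j : ℝ) + 2) ^ 3 / (2 : ℝ) ^ (j + 1) * u j) {k : ℕ} (hk : 1 ≤ k) :
    ∑ M ∈ range ((Q * k) ^ 3), G M * cubeTail q 3 M
      ≤ (k : ℝ) ^ 3 * (Q : ℝ) ^ 2 * ∑' j : ℕ, ((j : ℝ) + 2) ^ 3 / (2 : ℝ) ^ (j + 1) * u j := by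
  have hk' : (1 : ℝ) ≤ k := by exact_mod_cast hk
  have hQ : 1 ≤ Q := Nat.one_le_iff_ne_zero.2 (NeZero.ne Q)
  have h := sum_mul_cubeTail_le hq 3 ((Q * k) ^ 3) (fun M => G M)
    (b := fun j => ((k : ℝ) * ((j : ℝ) + 2)) ^ 3 * ((Q : ℝ) ^ 2 * u j)) ?_ (fun _ => hG _) ?_
  · refine h.trans (le_of_eq ?_)
    rw [← tsum_mul_left]
    refine tsum_congr fun j => ?_
    ring
  · intro j
    have h1 := sum_mul_cubeReps_shift_le 3 (F := fun m => G (m : ZMod Q)) (fun _ => hG _) (Q * k) j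
    simp only [Int.cast_natCast] at h1
    refine h1.trans ?_
    have hle : Q * k + j + 1 ≤ Q * (k + j + 1) := by nlinarith
    refine (sum_mul_cubeReps_three_le (F := fun m : ℕ => G (((m : ℤ) - ((j + 1 : ℕ) : ℤ) : ℤ) :
      ZMod Q)) (fun _ => hG _) (Nat.pow_le_pow_left hle 3)).trans ?_
    have h2 : ∀ x y z : ℕ, G ((((x ^ 3 + (y ^ 3 + z ^ 3) : ℕ) : ℤ) - ((j + 1 : ℕ) : ℤ) : ℤ) : ZMod Q)
        = G ((x : ZMod Q) ^ 3 + (y : ZMod Q) ^ 3 + (z : ZMod Q) ^ 3 - (j + 1 : ℕ)) := by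
      intro x y z
      push_cast
      rw [add_assoc ((x : ZMod Q) ^ 3)]
    simp only [h2]
    have h3 : ∀ x y : ZMod Q, ∑ z ∈ range (Q * (k + j + 1)),
        G (x ^ 3 + y ^ 3 + (z : ZMod Q) ^ 3 - ((j + 1 : ℕ) : ZMod Q)) = ((k + j + 1 : ℕ) : ℝ) *
        ∑ z : ZMod Q, G (x ^ 3 + y ^ 3 + z ^ 3 - ((j + 1 : ℕ) : ZMod Q)) := fun x y =>
      sum_range_mul_zmod (k + j + 1) fun z => G (x ^ 3 + y ^ 3 + z ^ 3 - ((j + 1 : ℕ) : ZMod Q))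
    have h4 : ∀ x : ZMod Q, ∑ y ∈ range (Q * (k + j + 1)),
        ∑ z : ZMod Q, G (x ^ 3 + (y : ZMod Q) ^ 3 + z ^ 3 - ((j + 1 : ℕ) : ZMod Q)) = ((k + j + 1 : ℕ) : ℝ) *
        ∑ y : ZMod Q, ∑ z : ZMod Q, G (x ^ 3 + y ^ 3 + z ^ 3 - ((j + 1 : ℕ) : ZMod Q)) := fun x =>
      sum_range_mul_zmod (k + j + 1) fun y =>
        ∑ z : ZMod Q, G (x ^ 3 + y ^ 3 + z ^ 3 - ((j + 1 : ℕ) : ZMod Q))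
    have h5 := sum_range_mul_zmod (k + j + 1) fun x : ZMod Q =>
      ∑ y : ZMod Q, ∑ z : ZMod Q, G (x ^ 3 + y ^ 3 + z ^ 3 - ((j + 1 : ℕ) : ZMod Q))
    simp only [h3, ← mul_sum, h4, h5]
    have h6 : ((k + j + 1 : ℕ) : ℝ) ≤ k * (j + 2) := by
      push_cast
      nlinarith [mul_nonneg (sub_nonneg.2 hk') (Nat.cast_nonneg (α := ℝ) j)]
    have h7 : 0 ≤ ∑ x : ZMod Q, ∑ y : ZMod Q, ∑ z : ZMod Q,
        G (x ^ 3 + y ^ 3 + z ^ 3 - (j + 1 : ℕ)) :=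
      sum_nonneg fun _ _ => sum_nonneg fun _ _ => sum_nonneg fun _ _ => hG _
    calc _ = ((k + j + 1 : ℕ) : ℝ) ^ 3 * ∑ x : ZMod Q, ∑ y : ZMod Q, ∑ z : ZMod Q,
        G (x ^ 3 + y ^ 3 + z ^ 3 - (j + 1 : ℕ)) := by ring
      _ ≤ _ := mul_le_mul (by gcongr) (hu j) h7 (by positivity)
  · refine (hs.mul_left ((k : ℝ) ^ 3 * (Q : ℝ) ^ 2)).congr fun j => ?_
    ring

lemma exists_cube_le_lt (M : ℕ) : ∃ x, x ^ 3 ≤ M ∧ M < (x + 1) ^ 3 := by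
  refine ⟨Nat.findGreatest (fun x => x ^ 3 ≤ M) M, ?_, ?_⟩
  · exact Nat.findGreatest_spec (P := fun x => x ^ 3 ≤ M) (Nat.zero_le _) (by simp)
  · by_contra! h
    have h1 := Nat.le_findGreatest (P := fun x => x ^ 3 ≤ M)
      ((Nat.le_self_pow (by norm_num) _).trans h) h
    omega

lemma exists_cube_remainder {M R : ℕ} (h : M < R ^ 3) :
    ∃ x d, M = x ^ 3 + d ∧ x < R ∧ d ≤ 3 * x ^ 2 + 3 * x := by
  obtain ⟨x, hx, hx'⟩ := exists_cube_le_lt M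
  refine ⟨x, M - x ^ 3, by omega, lt_of_pow_lt_pow_left₀ 3 (Nat.zero_le _) (hx.trans_lt h), ?_⟩
  have : (x + 1) ^ 3 = x ^ 3 + 3 * x ^ 2 + 3 * x + 1 := by ring
  omega

lemma exists_cubeReps_three_pos {t M : ℕ} (ht : 1 ≤ t) (hM : M < t ^ 27) :
    ∃ i ≤ 37 * t ^ 8, 0 < cubeReps 3 (M + 1 + i) := by
  obtain ⟨x, d, rfl, hx, hd⟩ := exists_cube_remainder (R := t ^ 9) (by rwa [← pow_mul])
  have hd' : d < 3 * (t ^ 9) ^ 2 := by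
    have h1 : x + 1 ≤ t ^ 9 := hx
    nlinarith [Nat.mul_le_mul h1 h1]
  have p6 : 1 ≤ t ^ 6 := Nat.one_le_pow _ _ ht
  have p4 : 1 ≤ t ^ 4 := Nat.one_le_pow _ _ ht
  obtain ⟨y, e, rfl, hy, he⟩ := exists_cube_remainder (M := d) (R := 2 * t ^ 6) (by
    refine hd'.trans_le ?_
    rw [mul_pow, ← pow_mul, ← pow_mul]
    norm_num
    gcongr
    norm_num)
  have he' : e < 12 * (t ^ 6) ^ 2 := by
    have h1 : y + 1 ≤ 2 * t ^ 6 := hy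
    nlinarith [Nat.mul_le_mul h1 h1]
  obtain ⟨z, f, rfl, hz, hf⟩ := exists_cube_remainder (M := e) (R := 3 * t ^ 4) (by
    refine he'.trans_le ?_
    rw [mul_pow, ← pow_mul, ← pow_mul]
    norm_num
    gcongr
    norm_num)
  have h1 : z + 1 ≤ 3 * t ^ 4 := hz
  have h2 : t ^ 8 = (t ^ 4) ^ 2 := by rw [← pow_mul]
  have h3 : (z + 1) ^ 3 = z ^ 3 + 3 * z ^ 2 + 3 * z + 1 := by ring
  have h4 := cubeReps_three_pos x y (z + 1)
  refine ⟨3 * z ^ 2 + 3 * z - f, ?_, ?_⟩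
  · have : 3 * z ^ 2 + 3 * z ≤ 37 * t ^ 8 := by
      rw [h2]
      nlinarith [Nat.mul_le_mul h1 h1]
    omega
  · rw [h3] at h4
    convert h4 using 2
    omega

end counting

section conclusion
variable {q : ℕ} {c₁ c₂ c₃ : ℤ}

lemma card_le_of_le_cubeTail_two {K β : ℝ} (hβ : 0 < β)
    (hK : ∀ Y : ℕ, 1 ≤ Y → ∑ b ∈ range (Y ^ 3), cubeTail q 2 b ≤ K * (Y : ℝ) ^ 2)
    {t : ℕ} (ht : 1 ≤ t) {Z : Finset ℕ}
    (hZ : ∀ M ∈ Z, M < t ^ 27 ∧ ∃ b, M ≤ b ∧ b ≤ M + 37 * t ^ 8 ∧ β ≤ cubeTail q 2 b) :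
    β * #Z ≤ 608 * K * (t : ℝ) ^ 26 := by
  classical
  set B := (range ((4 * t ^ 9) ^ 3)).filter fun b => β ≤ cubeTail q 2 b with hB
  have ht8 : 1 ≤ t ^ 8 := Nat.one_le_pow _ _ ht
  have hsub : Z ⊆ B.biUnion fun b => Icc (b - 37 * t ^ 8) b := by
    intro M hM
    obtain ⟨hMt, b, hb1, hb2, hb3⟩ := hZ M hM
    refine mem_biUnion.2 ⟨b, mem_filter.2 ⟨mem_range.2 ?_, hb3⟩, mem_Icc.2 ⟨by omega, hb1⟩⟩
    have h1 : (4 * t ^ 9) ^ 3 = 64 * t ^ 27 := by ring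
    have h2 : t ^ 8 ≤ t ^ 27 := Nat.pow_le_pow_right ht (by norm_num)
    omega
  have hcard : #Z ≤ #B * (38 * t ^ 8) := by
    refine (card_le_card hsub).trans (card_biUnion_le_card_mul _ _ _ fun b _ => ?_)
    rw [Nat.card_Icc]
    omega
  have hBK : #B * β ≤ 16 * K * (t : ℝ) ^ 18 := by
    calc (#B : ℝ) * β ≤ ∑ b ∈ B, cubeTail q 2 b := by
          rw [← nsmul_eq_mul]
          exact card_nsmul_le_sum _ _ _ fun b hb => (mem_filter.1 hb).2
      _ ≤ ∑ b ∈ range ((4 * t ^ 9) ^ 3), cubeTail q 2 b :=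
          sum_le_sum_of_subset_of_nonneg (filter_subset _ _) fun b _ _ => cubeTail_nonneg q 2 b
      _ ≤ K * ((4 * t ^ 9 : ℕ) : ℝ) ^ 2 := hK _ (by
          have := Nat.one_le_pow 9 t ht
          omega)
      _ = _ := by push_cast; ring
  calc β * #Z ≤ β * (#B * (38 * (t : ℝ) ^ 8)) := by
        gcongr
        exact_mod_cast hcard
    _ = #B * β * (38 * (t : ℝ) ^ 8) := by ring
    _ ≤ 16 * K * (t : ℝ) ^ 18 * (38 * (t : ℝ) ^ 8) := by gcongr
    _ = _ := by ring

lemma half_le_card_tailComb_eq_zero (hq : 2 ≤ q) {N : ℕ}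
    (hT : ∀ M, ∃ n : ℤ, tailComb q c₁ c₂ c₃ M = n) {F : ℕ → ℝ} (hF0 : ∀ M, 0 ≤ F M)
    (hF1 : ∀ M, F M ≤ 1) {n : ℝ} (hn : ∑ M ∈ range N, F M = n)
    (hF : (|(c₁ : ℝ)| + |(c₂ : ℝ)| + |(c₃ : ℝ)|) * ∑ M ∈ range N, F M * cubeTail q 3 M ≤ n / 2) :
    n / 2 ≤ #{M ∈ range N | tailComb q c₁ c₂ c₃ M = 0} := by
  have h1 : ∀ M, F M ≤ (|(c₁ : ℝ)| + |(c₂ : ℝ)| + |(c₃ : ℝ)|) * (F M * cubeTail q 3 M)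
      + if tailComb q c₁ c₂ c₃ M = 0 then 1 else 0 := by
    intro M
    have h2 := abs_tailComb_le hq c₁ c₂ c₃ M
    have h3 := mul_le_mul_of_nonneg_left h2 (hF0 M)
    split_ifs with h
    · rw [h, abs_zero, mul_zero] at h3
      linarith [hF1 M]
    · have h4 : 1 ≤ |tailComb q c₁ c₂ c₃ M| := by
        obtain ⟨m, hm⟩ := hT M
        rw [hm] at h ⊢
        exact_mod_cast Int.one_le_abs (by exact_mod_cast h)
      nlinarith [hF0 M]
  have h2 := sum_le_sum fun M (_ : M ∈ range N) => h1 M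
  rw [sum_add_distrib, ← mul_sum, hn, sum_boole] at h2
  linarith

theorem not_theta3_cubic_relation (hq : 2 ≤ q) {c₀ : ℤ} (hc : 1 ≤ c₃) :
    c₀ + c₁ * theta3 q + c₂ * theta3 q ^ 2 + c₃ * theta3 q ^ 3 ≠ 0 := by
  intro h
  obtain ⟨K, hK0, hK⟩ := exists_sum_cubeTail_two_le
  have hc' : (1 : ℝ) ≤ c₃ := by exact_mod_cast hc
  set C := |(c₁ : ℝ)| + |(c₂ : ℝ)| + |(c₃ : ℝ)| with hC
  have hC0 : 0 < C := by
    rw [hC, abs_of_nonneg (zero_le_one.trans hc')]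
    linarith [abs_nonneg (c₁ : ℝ), abs_nonneg (c₂ : ℝ)]
  have hq0 : (0 : ℝ) < q := by positivity
  obtain ⟨Q, u, ⟨_, G, hG0, hG1, hGu⟩, hs, hle⟩ := exists_hasCubeWeight_tsum_le
    (w := fun j : ℕ => ((j : ℝ) + 2) ^ 3 / (2 : ℝ) ^ (j + 1)) (fun j => by positivity)
    (summable_add_two_pow_div 3) (ε := 1 / (2 * C)) (by positivity)
  have hQ : 0 < Q := Nat.pos_of_ne_zero (NeZero.ne Q)
  have hQ' : (0 : ℝ) < Q := by exact_mod_cast hQ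
  obtain ⟨s, hs'⟩ := exists_nat_gt (1216 * Q * K * (C * q))
  have hs0 : (0 : ℝ) < s := lt_of_le_of_lt (by positivity) hs'
  have hs1 : 1 ≤ s := by exact_mod_cast hs0
  set t := Q * s with ht
  have hst : s ≤ t := Nat.le_mul_of_pos_left s hQ
  have ht1 : 1 ≤ t := hs1.trans hst
  have hZ := half_le_card_tailComb_eq_zero (N := t ^ 27) hq (exists_int_eq_tailComb hq h)
    (F := fun M => G M) (n := ((Q ^ 26 * s ^ 27 : ℕ) : ℝ)) (fun _ => hG0 _)
    (fun M => hG1 ▸ single_le_sum (f := G) (fun a _ => hG0 a) (mem_univ _))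
    (by
      have e : t ^ 27 = Q * (Q ^ 26 * s ^ 27) := by rw [ht]; ring
      rw [e, sum_range_mul_zmod, hG1, mul_one])
    (by
      have e : t ^ 27 = (Q * (Q ^ 8 * s ^ 9)) ^ 3 := by rw [ht]; ring
      have h1 := sum_weight_mul_cubeTail_three_le hq hG0 hGu hs (k := Q ^ 8 * s ^ 9)
        (Nat.one_le_iff_ne_zero.2 (by positivity))
      rw [e, ← hC]
      calc _ ≤ C * (((Q ^ 8 * s ^ 9 : ℕ) : ℝ) ^ 3 * (Q : ℝ) ^ 2 * (1 / (2 * C))) := by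
            gcongr
            refine h1.trans ?_
            gcongr
        _ = _ := by
          push_cast
          field_simp)
  have hcard := card_le_of_le_cubeTail_two (q := q) (β := 1 / (C * q)) (by positivity)
    (fun Y hY => hK q Y hq hY) ht1 (Z := {M ∈ range (t ^ 27) | tailComb q c₁ c₂ c₃ M = 0}) (by
      intro M hM
      obtain ⟨hM1, hM2⟩ := mem_filter.1 hM
      rw [mem_range] at hM1
      obtain ⟨i, hi, hpos⟩ := exists_cubeReps_three_pos ht1 hM1
      obtain ⟨b, hb1, hb2, hb3⟩ := exists_le_cubeTail_two hq hc hM2 hpos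
      exact ⟨hM1, b, hb1, by omega, hb3⟩)
  have e : (t : ℝ) ^ 27 = Q * ((Q ^ 26 * s ^ 27 : ℕ) : ℝ) := by
    rw [ht]
    push_cast
    ring
  have h1 : (t : ℝ) ^ 27 ≤ 1216 * Q * K * (C * q) * (t : ℝ) ^ 26 := by
    rw [one_div, inv_mul_le_iff₀ (by positivity)] at hcard
    rw [e]
    nlinarith [mul_le_mul_of_nonneg_left (hZ.trans hcard) hQ'.le]
  have ht0 : (0 : ℝ) < (t : ℝ) ^ 26 := by
    have : (0 : ℝ) < t := by exact_mod_cast ht1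
    positivity
  rw [pow_succ' (t : ℝ) 26] at h1
  have h2 := le_of_mul_le_mul_right h1 ht0
  have h3 : (s : ℝ) ≤ t := by exact_mod_cast hst
  linarith

theorem theta3_relation_eq_zero (hq : 2 ≤ q) {c₀ : ℤ}
    (h : c₀ + c₁ * theta3 q + c₂ * theta3 q ^ 2 + c₃ * theta3 q ^ 3 = 0) :
    c₀ = 0 ∧ c₁ = 0 ∧ c₂ = 0 ∧ c₃ = 0 := by
  have cubic : ∀ a b c d : ℤ,
      a + b * theta3 q + c * theta3 q ^ 2 + d * theta3 q ^ 3 = 0 → d = 0 := by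
    intro a b c d habcd
    rcases lt_trichotomy d 0 with hd | hd | hd
    · refine absurd ?_ (not_theta3_cubic_relation (c₀ := -a) (c₁ := -b) (c₂ := -c) (c₃ := -d) hq
        (by omega))
      push_cast
      linear_combination -habcd
    · exact hd
    · exact absurd habcd (not_theta3_cubic_relation hq hd)
  have h3 := cubic _ _ _ _ h
  subst h3
  have h2 := cubic 0 c₀ c₁ c₂ (by push_cast at h ⊢; linear_combination theta3 q * h)
  subst h2
  have h1 := cubic 0 0 c₀ c₁ (by push_cast at h ⊢; linear_combination theta3 q ^ 2 * h)
  subst h1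
  refine ⟨?_, rfl, rfl, rfl⟩
  simpa using h

end conclusion

end theta

/-- For an integer `q ≥ 2`, the number `θ₃(q)` is not a root of any nonzero
polynomial with integer coefficients of degree at most `3`; equivalently,
`1, θ₃(q), θ₃(q)², θ₃(q)³` are linearly independent over `ℚ`. -/
theorem theta3_not_algebraic_of_degree_le_three (q : ℕ) (hq : 2 ≤ q) :
    (∀ P : Polynomial ℤ, P ≠ 0 → P.natDegree ≤ 3 →
      Polynomial.aeval (theta3 q) P ≠ 0) ∧
    LinearIndependent ℚ ![1, theta3 q, theta3 q ^ 2, theta3 q ^ 3] := by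
  constructor
  · intro P hP hdeg h
    rw [Polynomial.aeval_eq_sum_range' (n := 4) (by omega)] at h
    simp only [Finset.sum_range_succ, Finset.sum_range_zero, zsmul_eq_mul, zero_add, pow_zero,
      mul_one, pow_one] at h
    obtain ⟨h0, h1, h2, h3⟩ := theta3_relation_eq_zero hq h
    refine hP (Polynomial.ext fun n => ?_)
    rw [Polynomial.coeff_zero]
    rcases lt_or_ge n 4 with hn | hn
    · interval_cases n <;> assumption
    · exact Polynomial.coeff_eq_zero_of_natDegree_lt (by omega)
  · rw [← LinearIndependent.iff_fractionRing ℤ ℚ, Fintype.linearIndependent_iff]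
    intro g h
    simp only [Fin.sum_univ_four, zsmul_eq_mul, Matrix.cons_val, mul_one] at h
    obtain ⟨h0, h1, h2, h3⟩ := theta3_relation_eq_zero hq h
    intro i
    fin_cases i <;> assumption
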